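/- Let (B, H, μ) be an abstract Wiener space, i.e., B a real separable Banach space with Gaussian measure μ. Then there exists δ > 0 such that ∫_B exp(δ ‖x‖_B²) dμ(x) < ∞. -/

import Mathlib

open MeasureTheory

theorem stmt_3 {B : Type*} [NormedAddCommGroup B] [NormedSpace ℝ B]
    [MeasurableSpace B] [BorelSpace B] [SecondCountableTopology B]
    (μ : Measure B) [IsProbabilityMeasure μ]
    (hgauss : ∀ ξ : B →L[ℝ] ℝ, ∃ v : NNReal,
      Measure.map ξ μ = ProbabilityTheory.gaussianReal 0 v) :
    ∃ δ > (0 : ℝ), Integrable (fun x => Real.exp (δ * ‖x‖ ^ 2)) μ := by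
  -- `B` is not assumed complete, so we apply Fernique's theorem on its completion.
  have : ProbabilityTheory.IsGaussian μ :=
    ProbabilityTheory.isGaussian_of_map_eq_gaussianReal fun ξ => ⟨0, hgauss ξ⟩
  let : MeasurableSpace (UniformSpace.Completion B) := borel _
  have : BorelSpace (UniformSpace.Completion B) := ⟨rfl⟩
  have : SecondCountableTopology (UniformSpace.Completion B) :=
    UniformSpace.secondCountable_of_separable _
  let ι : B →L[ℝ] UniformSpace.Completion B := UniformSpace.Completion.toComplL
  obtain ⟨δ, hδ, hint⟩ := ProbabilityTheory.IsGaussian.exists_integrable_exp_sq (μ.map ι)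
  refine ⟨δ, hδ, ?_⟩
  rw [integrable_map_measure (by fun_prop) (by fun_prop)] at hint
  simpa [Function.comp_def, ι] using hint
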